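/- arXiv:1112.3263 — 3 statements merged into one kernel-verified Lean document; each statement's English description precedes it below -/
import Mathlib

section
/- (Calabi–Markus phenomenon) Every subgroup Γ of SL(2,ℝ) whose action on the punctured plane ℝ² ∖ {0} by matrix multiplication is properly discontinuous is finite. -/
/-- A real binary quadratic form that is not definite vanishes at a point of the unit circle. -/
theorem exists_unit_isotropic {A B C : ℝ} (h : A * C ≤ B ^ 2) :
    ∃ x y : ℝ, x ^ 2 + y ^ 2 = 1 ∧ A * x ^ 2 + 2 * B * (x * y) + C * y ^ 2 = 0 := by
  by_cases hA : A = 0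
  · exact ⟨1, 0, by norm_num, by simp [hA]⟩
  obtain ⟨x, hx⟩ : ∃ x, A * x ^ 2 + 2 * B * (x * A) + C * A ^ 2 = 0 := by
    refine ⟨-B + √(B ^ 2 - A * C), ?_⟩
    linear_combination A * Real.sq_sqrt (sub_nonneg.2 h)
  have hpos : 0 < x ^ 2 + A ^ 2 := by positivity
  have hs : √(x ^ 2 + A ^ 2) ≠ 0 := (Real.sqrt_pos.2 hpos).ne'
  have hsq := Real.sq_sqrt hpos.le
  refine ⟨x / √(x ^ 2 + A ^ 2), A / √(x ^ 2 + A ^ 2), ?_, ?_⟩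
  · rw [div_pow, div_pow, hsq, ← add_div, div_self hpos.ne']
  · rw [div_mul_div_comm, ← sq √(x ^ 2 + A ^ 2), div_pow, div_pow, hsq]
    field_simp
    linear_combination hx

/-- The unit circle for the Euclidean norm is compact in `Fin 2 → ℝ`. -/
theorem isCompact_setOf_sq_add_sq_eq_one :
    IsCompact {v : Fin 2 → ℝ | v 0 ^ 2 + v 1 ^ 2 = 1} := by
  refine (isCompact_Icc (a := fun _ ↦ (-1 : ℝ)) (b := fun _ ↦ 1)).of_isClosed_subset
    (isClosed_eq (by fun_prop) continuous_const) fun v hv ↦ ?_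
  have hv : v 0 ^ 2 + v 1 ^ 2 = 1 := hv
  simp only [Set.mem_Icc, Pi.le_def, Fin.forall_fin_two]
  refine ⟨⟨?_, ?_⟩, ?_, ?_⟩ <;> nlinarith [sq_nonneg (v 0), sq_nonneg (v 1)]

/-- Every element of `SL(2,ℝ)` maps some point of the unit circle into the unit circle. -/
theorem Matrix.SpecialLinearGroup.exists_unit_mulVec_unit
    (g : Matrix.SpecialLinearGroup (Fin 2) ℝ) :
    ∃ v : Fin 2 → ℝ, v 0 ^ 2 + v 1 ^ 2 = 1 ∧
      g.val.mulVec v 0 ^ 2 + g.val.mulVec v 1 ^ 2 = 1 := by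
  have hdet := g.det_coe
  rw [Matrix.det_fin_two] at hdet
  generalize ha : g.val 0 0 = a at *
  generalize hb : g.val 0 1 = b at *
  generalize hc : g.val 1 0 = c at *
  generalize hd : g.val 1 1 = d at *
  obtain ⟨x, y, hxy, h⟩ := exists_unit_isotropic (A := a ^ 2 + c ^ 2 - 1)
    (B := a * b + c * d) (C := b ^ 2 + d ^ 2 - 1) (by
      nlinarith [sq_nonneg (a - d), sq_nonneg (b + c), congrArg (· ^ 2) hdet])
  refine ⟨![x, y], by simpa using hxy, ?_⟩
  simp only [Matrix.mulVec, dotProduct, Fin.sum_univ_two, ha, hb, hc, hd,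
    Matrix.cons_val_zero, Matrix.cons_val_one]
  linear_combination h + hxy

/-- **Calabi–Markus phenomenon.** Every subgroup `Γ` of `SL(2,ℝ)` whose action on the
punctured plane `ℝ² ∖ {0}` by matrix multiplication is properly discontinuous is finite. -/
theorem calabi_markus_phenomenon (Γ : Subgroup (Matrix.SpecialLinearGroup (Fin 2) ℝ))
    (hpd : ∀ K : Set (Fin 2 → ℝ), IsCompact K → K ⊆ {v | v ≠ 0} →
      {γ : Γ | ∃ v ∈ K,
        (γ : Matrix.SpecialLinearGroup (Fin 2) ℝ).val.mulVec v ∈ K}.Finite) :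
    Finite Γ := by
  refine Set.finite_univ_iff.1 ((hpd _ isCompact_setOf_sq_add_sq_eq_one ?_).subset fun γ _ ↦
    γ.val.exists_unit_mulVec_unit)
  rintro v hv rfl
  simp at hv
end

section
/- For (u,v) ∈ ℝ² let φ_{u,v} : ℝ² → ℝ² be the affine transformation φ_{u,v}(x,y) = (u + x + v·y + v²/2, v + y). Then (u,v) ↦ φ_{u,v} is an injective group homomorphism from the additive group (ℝ², +) into the group of affine automorphisms of ℝ² (in particular φ_{u,v} ∘ φ_{u',v'} = φ_{u+u', v+v'}), and the resulting action of ℝ² on ℝ² is simply transitive: for all p, q ∈ ℝ² there is exactly one (u,v) ∈ ℝ² with φ_{u,v}(p) = q. -/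
/-- The linear shear `(x, y) ↦ (x + v * y, y)` of the plane. -/
def planeShear (v : ℝ) : (ℝ × ℝ) ≃ₗ[ℝ] (ℝ × ℝ) where
  toFun z := (z.1 + v * z.2, z.2)
  invFun z := (z.1 - v * z.2, z.2)
  map_add' z w := by ext <;> simp; ring
  map_smul' c z := by ext <;> simp; ring
  left_inv z := by simp
  right_inv z := by simp

/-- The affine automorphism `(x, y) ↦ (u + x + v * y + v ^ 2 / 2, v + y)` of the plane,
where `w = (u, v)`. -/
noncomputable def etaleTypeD (w : ℝ × ℝ) : (ℝ × ℝ) ≃ᵃ[ℝ] (ℝ × ℝ) where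
  toFun z := (w.1 + z.1 + w.2 * z.2 + w.2 ^ 2 / 2, w.2 + z.2)
  invFun z := (-w.1 + z.1 - w.2 * z.2 + w.2 ^ 2 / 2, -w.2 + z.2)
  left_inv z := by ext <;> simp; ring
  right_inv z := by ext <;> simp; ring
  linear := planeShear w.2
  map_vadd' z d := by ext <;> simp [planeShear] <;> ring

theorem etaleTypeD_apply (w z : ℝ × ℝ) :
    etaleTypeD w z = (w.1 + z.1 + w.2 * z.2 + w.2 ^ 2 / 2, w.2 + z.2) := rfl

theorem etaleTypeD_add (p q : ℝ × ℝ) : etaleTypeD (p + q) = etaleTypeD p * etaleTypeD q := by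
  ext z <;> simp [etaleTypeD_apply, AffineEquiv.mul_def] <;> ring

theorem etaleTypeD_existsUnique (p q : ℝ × ℝ) : ∃! w : ℝ × ℝ, etaleTypeD w p = q := by
  refine ⟨(q.1 - p.1 - (q.2 - p.2) * p.2 - (q.2 - p.2) ^ 2 / 2, q.2 - p.2), ?_, ?_⟩
  · ext <;> simp [etaleTypeD_apply]; ring
  · rintro ⟨u, v⟩ rfl
    ext <;> simp [etaleTypeD_apply]; ring

theorem etaleTypeD_injective : Function.Injective etaleTypeD := fun p q h =>
  (etaleTypeD_existsUnique 0 (etaleTypeD q 0)).unique (by rw [h]) rfl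

/-- The family `φ_{u,v}(x,y) = (u + x + v·y + v²/2, v + y)` is an injective group
homomorphism from `(ℝ², +)` into the group of affine automorphisms of `ℝ²`, and the
resulting action of `ℝ²` on `ℝ²` is simply transitive. -/
theorem etale_type_D_simply_transitive :
    ∃ φ : ℝ × ℝ → ((ℝ × ℝ) ≃ᵃ[ℝ] (ℝ × ℝ)),
      (∀ u v x y : ℝ, φ (u, v) (x, y) = (u + x + v * y + v ^ 2 / 2, v + y)) ∧
      (∀ p q : ℝ × ℝ, φ (p + q) = φ p * φ q) ∧
      Function.Injective φ ∧
      (∀ p q : ℝ × ℝ, ∃! w : ℝ × ℝ, φ w p = q) := by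
  exact ⟨etaleTypeD, fun u v x y => etaleTypeD_apply (u, v) (x, y), etaleTypeD_add,
    etaleTypeD_injective, etaleTypeD_existsUnique⟩
end

section
/- Every 2×2 real matrix u with det u = 1 and trace u = 2 (in particular the unipotent matrix [[1, −1],[0, 1]]) lies in the closure, in the space of 2×2 real matrices, of the set { g R_φ g⁻¹ : g ∈ GL(2,ℝ), φ ∈ ℝ } of all matrices conjugate in GL(2,ℝ) to a rotation. Hence the set of conjugates of rotations is not closed, and its closure contains the conjugacy classes of the nontrivial unipotent matrices. -/
open Matrix

/-- A real `2 × 2` matrix of determinant `1` with trace in `(-2, 2)` is conjugate to a rotation. -/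
theorem exists_eq_conj_rotation (m : Matrix (Fin 2) (Fin 2) ℝ) (hdet : m.det = 1)
    (htr : m.trace ^ 2 < 4) :
    ∃ g : GL (Fin 2) ℝ, ∃ φ : ℝ, m = (g : Matrix (Fin 2) (Fin 2) ℝ) *
      !![Real.cos φ, Real.sin φ; -Real.sin φ, Real.cos φ] *
        ((g⁻¹ : GL (Fin 2) ℝ) : Matrix (Fin 2) (Fin 2) ℝ) := by
  rw [det_fin_two] at hdet
  rw [trace_fin_two] at htr
  obtain ⟨φ, hcos⟩ : ∃ φ : ℝ, Real.cos φ = (m 0 0 + m 1 1) / 2 :=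
    ⟨_, Real.cos_arccos (by nlinarith) (by nlinarith)⟩
  have hsq := Real.sin_sq_add_cos_sq φ
  have hsin : Real.sin φ ≠ 0 := by
    intro h
    rw [h, hcos] at hsq
    nlinarith
  have hm : m 1 0 ≠ 0 := by
    intro h
    rw [h] at hdet
    nlinarith [sq_nonneg (m 0 0 - m 1 1)]
  -- The first column is `e₁`; the second is forced by `m * g = g * R_φ`, up to the factor `sin φ`.
  let g : GL (Fin 2) ℝ := GeneralLinearGroup.mkOfDetNeZero
    !![Real.sin φ, Real.cos φ - m 0 0; 0, -m 1 0] (by simp [det_fin_two, hsin, hm])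
  refine ⟨g, φ, ?_⟩
  rw [Units.eq_mul_inv_iff_mul_eq]
  have hg : (g : Matrix (Fin 2) (Fin 2) ℝ) =
      !![Real.sin φ, Real.cos φ - m 0 0; 0, -m 1 0] := rfl
  rw [hg]
  ext i j
  fin_cases i <;> fin_cases j <;> simp [mul_apply, Fin.sum_univ_two]
  · ring
  · linear_combination 2 * m 0 0 * hcos + hdet - hsq
  · rw [hcos]; ring

/-- A real `2 × 2` matrix of determinant `1` and trace `2` is a limit of matrices of
determinant `1` with trace in `(-2, 2)`. -/
theorem mem_closure_det_one_trace_sq_lt_four (u : Matrix (Fin 2) (Fin 2) ℝ) (hdet : u.det = 1)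
    (htr : u.trace = 2) :
    u ∈ closure {m : Matrix (Fin 2) (Fin 2) ℝ | m.det = 1 ∧ m.trace ^ 2 < 4} := by
  rw [det_fin_two] at hdet
  rw [trace_fin_two] at htr
  obtain ⟨s, hs, hpos⟩ : ∃ s : ℝ, s ^ 2 = 1 ∧ 0 ≤ s * (u 1 0 - u 0 1) := by
    rcases le_total 0 (u 1 0 - u 0 1) with h | h
    · exact ⟨1, by norm_num, by linarith⟩
    · exact ⟨-1, by norm_num, by linarith⟩
  let d : ℝ → ℝ := fun ε => ε * (s * (u 1 0 - u 0 1)) + ε ^ 2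
  -- `f ε - √(1 - d ε)` is trace-free of determinant `d ε`, which is positive for `ε > 0`.
  let f : ℝ → Matrix (Fin 2) (Fin 2) ℝ := fun ε =>
    !![√(1 - d ε) + (u 0 0 - 1), u 0 1 - s * ε; u 1 0 + s * ε, √(1 - d ε) + (u 1 1 - 1)]
  have hd : Continuous d := by fun_prop
  have hf : Continuous f := by
    refine continuous_matrix fun i j => ?_
    fin_cases i <;> fin_cases j <;> simp [f] <;> fun_prop
  have hf0 : f 0 = u := by
    ext i j
    fin_cases i <;> fin_cases j <;> simp [f, d]
  have hlim : Filter.Tendsto f (nhdsWithin 0 (Set.Ioi 0)) (nhds u) := by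
    simpa only [hf0] using hf.continuousWithinAt.tendsto (x := 0) (s := Set.Ioi 0)
  refine mem_closure_of_tendsto hlim ?_
  have hd1 : ∀ᶠ ε in nhdsWithin (0 : ℝ) (Set.Ioi 0), d ε < 1 :=
    hd.continuousWithinAt.eventually_lt_const (by simp [d])
  filter_upwards [hd1, self_mem_nhdsWithin] with ε hε1 hε0
  have hε : 0 < ε := hε0
  have hdpos : 0 < d ε := by simp only [d]; positivity
  have hsqrt : √(1 - d ε) ^ 2 = 1 - d ε := Real.sq_sqrt (by linarith)
  have hu : u 1 1 = 2 - u 0 0 := by linarith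
  rw [hu] at hdet
  constructor
  · simp only [f, det_fin_two_of, hu]
    have hdε : d ε = ε * (s * (u 1 0 - u 0 1)) + ε ^ 2 := rfl
    linear_combination hsqrt + hdet - hdε + ε ^ 2 * hs
  · simp only [f, trace_fin_two_of, hu]
    nlinarith

/-- The only conjugate of a rotation with trace `2` is the identity. -/
theorem conj_rotation_eq_one_of_trace_eq_two (g : GL (Fin 2) ℝ) (φ : ℝ)
    (h : ((g : Matrix (Fin 2) (Fin 2) ℝ) *
      !![Real.cos φ, Real.sin φ; -Real.sin φ, Real.cos φ] *
        ((g⁻¹ : GL (Fin 2) ℝ) : Matrix (Fin 2) (Fin 2) ℝ)).trace = 2) :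
    (g : Matrix (Fin 2) (Fin 2) ℝ) *
      !![Real.cos φ, Real.sin φ; -Real.sin φ, Real.cos φ] *
        ((g⁻¹ : GL (Fin 2) ℝ) : Matrix (Fin 2) (Fin 2) ℝ) = 1 := by
  rw [trace_units_conj, trace_fin_two_of] at h
  have hcos : Real.cos φ = 1 := by linarith
  have hsin : Real.sin φ = 0 := Real.sin_eq_zero_iff_cos_eq.2 (Or.inl hcos)
  rw [hcos, hsin, neg_zero, ← one_fin_two, mul_one, Units.mul_inv]

/-- Every 2×2 real matrix with determinant 1 and trace 2 (in particular the unipotent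
matrix `[[1,−1],[0,1]]`) lies in the closure of the set of all matrices conjugate in
`GL(2,ℝ)` to a rotation; hence the set of conjugates of rotations is not closed. -/
theorem closure_of_rotation_conjugates :
    (∀ u : Matrix (Fin 2) (Fin 2) ℝ, u.det = 1 → u.trace = 2 →
      u ∈ closure {m : Matrix (Fin 2) (Fin 2) ℝ | ∃ g : GL (Fin 2) ℝ, ∃ φ : ℝ,
        m = (g : Matrix (Fin 2) (Fin 2) ℝ) *
          !![Real.cos φ, Real.sin φ; -Real.sin φ, Real.cos φ] *
            ((g⁻¹ : GL (Fin 2) ℝ) : Matrix (Fin 2) (Fin 2) ℝ)}) ∧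
    ¬ IsClosed {m : Matrix (Fin 2) (Fin 2) ℝ | ∃ g : GL (Fin 2) ℝ, ∃ φ : ℝ,
        m = (g : Matrix (Fin 2) (Fin 2) ℝ) *
          !![Real.cos φ, Real.sin φ; -Real.sin φ, Real.cos φ] *
            ((g⁻¹ : GL (Fin 2) ℝ) : Matrix (Fin 2) (Fin 2) ℝ)} := by
  have hclosure := fun (u : Matrix (Fin 2) (Fin 2) ℝ) (hdet : u.det = 1) (htr : u.trace = 2) =>
    closure_mono (fun m hm => exists_eq_conj_rotation m hm.1 hm.2)
      (mem_closure_det_one_trace_sq_lt_four u hdet htr)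
  refine ⟨hclosure, fun hclosed => ?_⟩
  have htr : (!![1, -1; 0, 1] : Matrix (Fin 2) (Fin 2) ℝ).trace = 2 := by
    rw [trace_fin_two_of]; norm_num
  have hmem := hclosure !![1, -1; 0, 1] (by simp [det_fin_two_of]) htr
  obtain ⟨g, φ, h⟩ := hclosed.closure_subset hmem
  have hone := h.trans (conj_rotation_eq_one_of_trace_eq_two g φ (h ▸ htr))
  simpa using congrFun (congrFun hone 0) 1
end
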